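/- arXiv:2506.23806 — 2 statements merged into one kernel-verified Lean document; each statement's English description precedes it below -/
import Mathlib

section
/- (Multiplicativity of the shadow norm, Eq. (12) of the paper for two factors) Let E¹ be an informationally complete POVM on ℂ^{d₁} and E² an informationally complete POVM on ℂ^{d₂}. Then for all Hermitian matrices X on ℂ^{d₁} and Y on ℂ^{d₂}, the squared shadow norm of the Kronecker product X ⊗ Y with respect to the tensor-product POVM E¹⊗E² factorizes: ‖X ⊗ Y‖²_{E¹⊗E²} = ‖X‖²_{E¹} · ‖Y‖²_{E²}. -/
open Matrix
open scoped Kronecker ComplexOrder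

def IsPOVM {n ι : Type*} [Fintype n] [DecidableEq n] [Fintype ι]
    (E : ι → Matrix n n ℂ) : Prop :=
  (∀ k, (E k).PosSemidef) ∧ ∑ k, E k = 1

noncomputable def frameOp {n ι : Type*} [Fintype n] [DecidableEq n] [Fintype ι]
    (E : ι → Matrix n n ℂ) : Matrix n n ℂ →ₗ[ℂ] Matrix n n ℂ where
  toFun A := ∑ k, (A * E k).trace • E k
  map_add' A B := by
    simp [add_mul, Matrix.trace_add, add_smul, Finset.sum_add_distrib]
  map_smul' c A := by
    simp [Matrix.smul_mul, Matrix.trace_smul, smul_smul, Finset.smul_sum]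

open Classical in
noncomputable def lambdaMax {n : Type*} [Fintype n] [DecidableEq n]
    (A : Matrix n n ℂ) : ℝ :=
  if h : A.IsHermitian then ⨆ k, h.eigenvalues k else 0

noncomputable def shadowNormSq {n ι : Type*} [Fintype n] [DecidableEq n] [Fintype ι]
    (E sh : ι → Matrix n n ℂ) (X : Matrix n n ℂ) : ℝ :=
  lambdaMax (∑ k, (((sh k * X).trace.re) ^ 2 : ℝ) • E k)

lemma frameOp_apply {n ι : Type*} [Fintype n] [DecidableEq n] [Fintype ι]
    (E : ι → Matrix n n ℂ) (A : Matrix n n ℂ) :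
    frameOp E A = ∑ k, (A * E k).trace • E k := rfl

lemma frameOp_kronecker {n m ι κ : Type*} [Fintype n] [DecidableEq n] [Fintype m] [DecidableEq m]
    [Fintype ι] [Fintype κ] (E : ι → Matrix n n ℂ) (F : κ → Matrix m m ℂ)
    (A : Matrix n n ℂ) (B : Matrix m m ℂ) :
    frameOp (fun k : ι × κ => E k.1 ⊗ₖ F k.2) (A ⊗ₖ B) = frameOp E A ⊗ₖ frameOp F B := by
  ext i j
  simp only [frameOp_apply, ← mul_kronecker_mul, trace_kronecker, Matrix.sum_apply, Matrix.smul_apply,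
    kroneckerMap_apply, Fintype.sum_prod_type, Finset.sum_mul_sum, smul_eq_mul]
  refine Finset.sum_congr rfl fun a _ => Finset.sum_congr rfl fun b _ => ?_
  ring

/-- The tensor product of informationally complete families is informationally complete. -/
lemma injective_frameOp_kronecker {n m ι κ : Type*} [Fintype n] [DecidableEq n] [Fintype m]
    [DecidableEq m] [Fintype ι] [Fintype κ] {E : ι → Matrix n n ℂ} {F : κ → Matrix m m ℂ}
    (hE : Function.Surjective (frameOp E)) (hF : Function.Surjective (frameOp F)) :
    Function.Injective (frameOp (fun k : ι × κ => E k.1 ⊗ₖ F k.2)) := by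
  rw [LinearMap.injective_iff_surjective, ← LinearMap.range_eq_top, eq_top_iff]
  rintro M -
  induction M using Matrix.induction_on' with
  | h_zero => exact Submodule.zero_mem _
  | h_add p q hp hq => exact Submodule.add_mem _ hp hq
  | h_std_basis i j x =>
    obtain ⟨A, hA⟩ := hE (single i.1 j.1 1)
    obtain ⟨B, hB⟩ := hF (single i.2 j.2 x)
    refine ⟨A ⊗ₖ B, ?_⟩
    rw [frameOp_kronecker, hA, hB, single_kronecker_single, one_mul]

lemma frameOp_conjTranspose {n ι : Type*} [Fintype n] [DecidableEq n] [Fintype ι]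
    {E : ι → Matrix n n ℂ} (hE : ∀ k, (E k).IsHermitian) (A : Matrix n n ℂ) :
    frameOp E Aᴴ = (frameOp E A)ᴴ := by
  simp only [frameOp_apply, conjTranspose_sum, conjTranspose_smul]
  refine Finset.sum_congr rfl fun k _ => ?_
  rw [← trace_conjTranspose, conjTranspose_mul, (hE k).eq, trace_mul_comm]

lemma isHermitian_of_frameOp {n ι : Type*} [Fintype n] [DecidableEq n] [Fintype ι]
    {E : ι → Matrix n n ℂ} (hE : ∀ k, (E k).IsHermitian)
    (hinj : Function.Injective (frameOp E)) {A : Matrix n n ℂ} (hA : (frameOp E A).IsHermitian) :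
    A.IsHermitian :=
  hinj ((frameOp_conjTranspose hE A).trans hA)

lemma trace_mul_im_eq_zero {n : Type*} [Fintype n] {A B : Matrix n n ℂ}
    (hA : A.IsHermitian) (hB : B.IsHermitian) : (A * B).trace.im = 0 := by
  rw [← Complex.conj_eq_iff_im, ← Complex.star_def, ← trace_conjTranspose, conjTranspose_mul,
    hA.eq, hB.eq, trace_mul_comm]

lemma posSemidef_lambdaMax_smul_one_sub {n : Type*} [Fintype n] [DecidableEq n]
    {A : Matrix n n ℂ} (hA : A.IsHermitian) :
    ((lambdaMax A : ℂ) • (1 : Matrix n n ℂ) - A).PosSemidef := by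
  have hdiag : ((lambdaMax A : ℂ) • (1 : Matrix n n ℂ)
      - diagonal (RCLike.ofReal ∘ hA.eigenvalues)).PosSemidef := by
    rw [smul_one_eq_diagonal, diagonal_sub]
    refine PosSemidef.diagonal fun i => ?_
    have : hA.eigenvalues i ≤ lambdaMax A := by
      rw [lambdaMax, dif_pos hA]
      exact le_ciSup (Finite.bddAbove_range _) i
    simpa using this
  have h := hdiag.mul_mul_conjTranspose_same (hA.eigenvectorUnitary : Matrix n n ℂ)
  have hU : (hA.eigenvectorUnitary : Matrix n n ℂ) * (hA.eigenvectorUnitary : Matrix n n ℂ)ᴴ = 1 :=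
    Unitary.coe_mul_star_self _
  have hS := hA.spectral_theorem
  rw [Unitary.conjStarAlgAut_apply] at hS
  rw [Matrix.mul_sub, Matrix.sub_mul, Matrix.mul_smul, Matrix.smul_mul, Matrix.mul_one, hU] at h
  rwa [← star_eq_conjTranspose, ← hS] at h

lemma exists_mulVec_eq_lambdaMax_smul {n : Type*} [Fintype n] [DecidableEq n] [Nonempty n]
    {A : Matrix n n ℂ} (hA : A.IsHermitian) :
    ∃ v : n → ℂ, v ≠ 0 ∧ A *ᵥ v = (lambdaMax A : ℂ) • v := by
  obtain ⟨i, hi⟩ := exists_eq_ciSup_of_finite (f := hA.eigenvalues)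
  refine ⟨hA.eigenvectorBasis i, fun h => ?_, ?_⟩
  · exact hA.eigenvectorBasis.orthonormal.ne_zero i (by ext j; exact congrFun h j)
  · rw [hA.mulVec_eigenvectorBasis, lambdaMax, dif_pos hA, ← hi]
    rfl

lemma eigenvalue_le_of_posSemidef {n : Type*} [Fintype n] [DecidableEq n]
    {A : Matrix n n ℂ} {c μ : ℝ} (h : ((c : ℂ) • (1 : Matrix n n ℂ) - A).PosSemidef)
    {v : n → ℂ} (hv : v ≠ 0) (hAv : A *ᵥ v = (μ : ℂ) • v) : μ ≤ c := by
  have h1 := h.dotProduct_mulVec_nonneg v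
  rw [sub_mulVec, smul_mulVec, one_mulVec, hAv, ← sub_smul, dotProduct_smul, smul_eq_mul] at h1
  have h2 : 0 < star v ⬝ᵥ v := dotProduct_star_self_pos_iff.mpr hv
  have h3 := (Complex.le_def.mp h1).1
  rw [← Complex.ofReal_sub, Complex.re_ofReal_mul, Complex.zero_re] at h3
  have h4 := nonneg_of_mul_nonneg_left h3 (Complex.lt_def.mp h2).1
  linarith

lemma lambdaMax_nonneg {n : Type*} [Fintype n] [DecidableEq n]
    {A : Matrix n n ℂ} (hA : A.PosSemidef) : 0 ≤ lambdaMax A := by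
  rw [lambdaMax, dif_pos hA.isHermitian]
  exact Real.iSup_nonneg hA.eigenvalues_nonneg

lemma lambdaMax_of_isEmpty {n : Type*} [Fintype n] [DecidableEq n] [IsEmpty n]
    (A : Matrix n n ℂ) : lambdaMax A = 0 := by
  rw [lambdaMax]
  split_ifs <;> simp

lemma kronecker_mulVec_mul {n m : Type*} [Fintype n] [Fintype m]
    (A : Matrix n n ℂ) (B : Matrix m m ℂ) (v : n → ℂ) (w : m → ℂ) :
    (A ⊗ₖ B) *ᵥ (fun p : n × m => v p.1 * w p.2) = fun p => (A *ᵥ v) p.1 * (B *ᵥ w) p.2 := by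
  ext p
  simp only [mulVec, dotProduct, kroneckerMap_apply, Fintype.sum_prod_type, Finset.sum_mul_sum]
  refine Finset.sum_congr rfl fun a _ => Finset.sum_congr rfl fun b _ => ?_
  ring

/-- The largest eigenvalue is multiplicative on Kronecker products of positive semidefinite
matrices. -/
lemma lambdaMax_kronecker {n m : Type*} [Fintype n] [DecidableEq n] [Fintype m] [DecidableEq m]
    {A : Matrix n n ℂ} {B : Matrix m m ℂ} (hA : A.PosSemidef) (hB : B.PosSemidef) :
    lambdaMax (A ⊗ₖ B) = lambdaMax A * lambdaMax B := by
  cases isEmpty_or_nonempty n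
  · rw [lambdaMax_of_isEmpty, lambdaMax_of_isEmpty A, zero_mul]
  cases isEmpty_or_nonempty m
  · rw [lambdaMax_of_isEmpty, lambdaMax_of_isEmpty B, mul_zero]
  have hAB := (hA.kronecker hB).isHermitian
  apply le_antisymm
  · obtain ⟨u, hu, hABu⟩ := exists_mulVec_eq_lambdaMax_smul hAB
    refine eigenvalue_le_of_posSemidef ?_ hu hABu
    have hone : ((lambdaMax B : ℂ) • (1 : Matrix m m ℂ)).PosSemidef :=
      PosSemidef.one.smul (by exact_mod_cast lambdaMax_nonneg hB)
    have h := ((posSemidef_lambdaMax_smul_one_sub hA.isHermitian).kronecker hone).add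
      (hA.kronecker (posSemidef_lambdaMax_smul_one_sub hB.isHermitian))
    refine (congrArg PosSemidef ?_).mpr h
    rw [← one_kronecker_one (α := ℂ) (m := n) (n := m)]
    ext p q
    simp only [Matrix.sub_apply, Matrix.add_apply, Matrix.smul_apply, kroneckerMap_apply, smul_eq_mul, Complex.ofReal_mul]
    ring
  · obtain ⟨v, hv, hAv⟩ := exists_mulVec_eq_lambdaMax_smul hA.isHermitian
    obtain ⟨w, hw, hBw⟩ := exists_mulVec_eq_lambdaMax_smul hB.isHermitian
    refine eigenvalue_le_of_posSemidef (posSemidef_lambdaMax_smul_one_sub hAB)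
      (v := fun p => v p.1 * w p.2) ?_ ?_
    · obtain ⟨i, hi⟩ := Function.ne_iff.mp hv
      obtain ⟨j, hj⟩ := Function.ne_iff.mp hw
      exact Function.ne_iff.mpr ⟨(i, j), mul_ne_zero hi hj⟩
    · rw [kronecker_mulVec_mul, hAv, hBw]
      ext p
      simp only [Pi.smul_apply, smul_eq_mul, Complex.ofReal_mul]
      ring

/-- multiplicativity of the shadow norm for two tensor factors. -/
theorem shadowNormSq_kronecker_mul
    {d₁ d₂ N₁ N₂ : ℕ}
    (E₁ : Fin N₁ → Matrix (Fin d₁) (Fin d₁) ℂ)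
    (E₂ : Fin N₂ → Matrix (Fin d₂) (Fin d₂) ℂ)
    (hE₁ : IsPOVM E₁) (hE₂ : IsPOVM E₂)
    (hIC₁ : Function.Bijective (frameOp E₁))
    (hIC₂ : Function.Bijective (frameOp E₂))
    (sh₁ : Fin N₁ → Matrix (Fin d₁) (Fin d₁) ℂ)
    (sh₂ : Fin N₂ → Matrix (Fin d₂) (Fin d₂) ℂ)
    (hsh₁ : ∀ a, frameOp E₁ (sh₁ a) = E₁ a)
    (hsh₂ : ∀ b, frameOp E₂ (sh₂ b) = E₂ b)
    (shTot : Fin N₁ × Fin N₂ → Matrix (Fin d₁ × Fin d₂) (Fin d₁ × Fin d₂) ℂ)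
    (hshTot : ∀ k, frameOp (fun k' : Fin N₁ × Fin N₂ => E₁ k'.1 ⊗ₖ E₂ k'.2) (shTot k)
        = E₁ k.1 ⊗ₖ E₂ k.2)
    (X : Matrix (Fin d₁) (Fin d₁) ℂ) (hX : X.IsHermitian)
    (Y : Matrix (Fin d₂) (Fin d₂) ℂ) (hY : Y.IsHermitian) :
    shadowNormSq (fun k : Fin N₁ × Fin N₂ => E₁ k.1 ⊗ₖ E₂ k.2) shTot (X ⊗ₖ Y)
      = shadowNormSq E₁ sh₁ X * shadowNormSq E₂ sh₂ Y := by
  have hshadow : ∀ k, shTot k = sh₁ k.1 ⊗ₖ sh₂ k.2 := fun k =>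
    injective_frameOp_kronecker hIC₁.surjective hIC₂.surjective
      (by rw [hshTot, frameOp_kronecker, hsh₁, hsh₂])
  have him : ∀ a, (sh₁ a * X).trace.im = 0 := fun a =>
    trace_mul_im_eq_zero (isHermitian_of_frameOp (fun k => (hE₁.1 k).isHermitian) hIC₁.injective
      (by rw [hsh₁]; exact (hE₁.1 a).isHermitian)) hX
  have hpos₁ : (∑ a, (((sh₁ a * X).trace.re) ^ 2 : ℝ) • E₁ a).PosSemidef :=
    posSemidef_sum _ fun a _ => (hE₁.1 a).smul (sq_nonneg _)
  have hpos₂ : (∑ b, (((sh₂ b * Y).trace.re) ^ 2 : ℝ) • E₂ b).PosSemidef :=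
    posSemidef_sum _ fun b _ => (hE₂.1 b).smul (sq_nonneg _)
  rw [shadowNormSq, shadowNormSq, shadowNormSq, ← lambdaMax_kronecker hpos₁ hpos₂]
  congr 1
  ext i j
  simp only [hshadow, ← mul_kronecker_mul, trace_kronecker, Complex.mul_re, him, zero_mul, sub_zero,
    Matrix.sum_apply, Matrix.smul_apply, kroneckerMap_apply, Fintype.sum_prod_type, Finset.sum_mul_sum,
    Complex.real_smul, Complex.ofReal_mul, Complex.ofReal_pow]
  refine Finset.sum_congr rfl fun a _ => Finset.sum_congr rfl fun b _ => ?_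
  ring
end

section
/- (Optimal single-qubit shadow norm of the octahedron measurement, used in the proof of Theorem 3) Let E = {E_k}_{k=1}^6 be the Pauli-6 (octahedron) POVM on ℂ², whose classical shadows are ρ̂_k = 9 E_k − I. Then for every rank-one orthogonal projection X on ℂ², the squared shadow norm satisfies ‖X‖²_E = λ_max( Σ_{k=1}^6 (Tr((9E_k − I) X))² E_k ) = 3/2. -/
open Matrix
open scoped Kronecker ComplexOrder

noncomputable def sigX : Matrix (Fin 2) (Fin 2) ℂ := !![0, 1; 1, 0]
noncomputable def sigY : Matrix (Fin 2) (Fin 2) ℂ := !![0, -Complex.I; Complex.I, 0]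
noncomputable def sigZ : Matrix (Fin 2) (Fin 2) ℂ := !![1, 0; 0, -1]

/-- The Pauli-6 (octahedron) POVM on ℂ²: effects `(1/6)(I + n·σ)`, `n ∈ {±e_x, ±e_y, ±e_z}`. -/
noncomputable def pauli6 : Fin 6 → Matrix (Fin 2) (Fin 2) ℂ :=
  ![(1/6 : ℂ) • (1 + sigX), (1/6 : ℂ) • (1 - sigX),
    (1/6 : ℂ) • (1 + sigY), (1/6 : ℂ) • (1 - sigY),
    (1/6 : ℂ) • (1 + sigZ), (1/6 : ℂ) • (1 - sigZ)]

/-- A Hermitian `2 × 2` matrix whose characteristic polynomial is `(x - a) * (x - b)` with `b ≤ a`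
has largest eigenvalue `a`. -/
theorem lambdaMax_fin_two_eq {A : Matrix (Fin 2) (Fin 2) ℂ} (hA : A.IsHermitian) {a b : ℝ}
    (hba : b ≤ a) (htr : A.trace = ((a + b : ℝ) : ℂ)) (hdet : A.det = ((a * b : ℝ) : ℂ)) :
    lambdaMax A = a := by
  have hsum : hA.eigenvalues 0 + hA.eigenvalues 1 = a + b := by
    have h := hA.trace_eq_sum_eigenvalues
    rw [htr, Fin.sum_univ_two] at h
    apply Complex.ofReal_injective
    simpa using h.symm
  have hprod : hA.eigenvalues 0 * hA.eigenvalues 1 = a * b := by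
    have h := hA.det_eq_prod_eigenvalues
    rw [hdet, Fin.prod_univ_two] at h
    apply Complex.ofReal_injective
    simpa using h.symm
  have hroots : (hA.eigenvalues 0 - a) * (hA.eigenvalues 0 - b) = 0 := by
    linear_combination hA.eigenvalues 0 * hsum - hprod
  rw [lambdaMax, dif_pos hA]
  apply le_antisymm
  · refine ciSup_le fun k => ?_
    rcases mul_eq_zero.mp hroots with h | h <;> fin_cases k <;> simp <;> linarith
  · rcases mul_eq_zero.mp hroots with h | h
    · exact (sub_eq_zero.mp h).ge.trans (le_ciSup (Finite.bddAbove_range _) 0)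
    · exact (show a ≤ hA.eigenvalues 1 by linarith).trans (le_ciSup (Finite.bddAbove_range _) 1)

theorem det_eq_zero_of_rank_lt {n K : Type*} [Fintype n] [DecidableEq n] [Field K]
    {A : Matrix n n K} (h : A.rank < Fintype.card n) : A.det = 0 := by
  by_contra hdet
  exact h.ne (Matrix.rank_of_isUnit A ((Matrix.isUnit_iff_isUnit_det A).mpr (Ne.isUnit hdet)))

theorem trace_eq_one_of_mul_self_eq_self {K : Type*} [Field K] {A : Matrix (Fin 2) (Fin 2) K}
    (hA : A * A = A) (hne : A ≠ 0) (hdet : A.det = 0) : A.trace = 1 := by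
  have h : (A.trace - 1) • A = 0 := by
    rw [sub_smul, one_smul, sub_eq_zero]
    nth_rewrite 3 [← hA]
    rw [Matrix.det_fin_two] at hdet
    ext i j
    fin_cases i <;> fin_cases j <;>
      simp [Matrix.mul_apply, Matrix.trace_fin_two, Fin.sum_univ_two] <;>
      first | ring1 | linear_combination hdet
  exact sub_eq_zero.mp ((smul_eq_zero.mp h).resolve_right hne)

/-- The operator whose largest eigenvalue is the squared shadow norm of a pure state. -/
theorem sum_pauli6_shadow_sq_smul {X : Matrix (Fin 2) (Fin 2) ℂ} (hX : X.IsHermitian)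
    (htr : X.trace = 1) (hdet : X.det = 0) :
    ∑ k, (((((9 : ℂ) • pauli6 k - 1) * X).trace.re) ^ 2 : ℝ) • pauli6 k =
      (1 / 2 : ℂ) • 1 + X := by
  have h00 := hX.apply 0 0
  have h10 := hX.apply 1 0
  have h11 := hX.apply 1 1
  rw [Matrix.trace_fin_two] at htr
  rw [Matrix.det_fin_two] at hdet
  rw [← h10] at hdet
  simp only [Complex.ext_iff, Complex.star_def, Complex.conj_re, Complex.conj_im, Complex.add_re,
    Complex.add_im, Complex.sub_re, Complex.sub_im, Complex.mul_re, Complex.mul_im,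
    Complex.one_re, Complex.one_im, Complex.zero_re, Complex.zero_im] at h00 h10 h11 htr hdet
  obtain ⟨-, h00⟩ := h00
  obtain ⟨h10r, h10i⟩ := h10
  obtain ⟨-, h11⟩ := h11
  obtain ⟨htr, -⟩ := htr
  obtain ⟨hdet, -⟩ := hdet
  have h00 : (X 0 0).im = 0 := by linarith
  have h11 : (X 1 1).im = 0 := by linarith
  have htr : (X 1 1).re = 1 - (X 0 0).re := by linarith
  rw [h00, htr] at hdet
  ext i j
  fin_cases i <;> fin_cases j <;> apply Complex.ext <;>
    simp [Fin.sum_univ_six, pauli6, sigX, sigY, sigZ, Matrix.trace_fin_two, Matrix.mul_apply,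
      Fin.sum_univ_two, Matrix.one_apply, sq, h00, h11, htr, ← h10r, ← h10i] <;>
    first | ring1 | linear_combination (-3 : ℝ) * hdet

/-- optimal single-qubit shadow norm of the octahedron measurement:
for every rank-one orthogonal projection `X` on ℂ², the squared shadow norm of `X`
with respect to the Pauli-6 POVM (whose classical shadows are `9 E_k − I`) equals `3/2`. -/
theorem pauli6_shadowNormSq_projection
    (X : Matrix (Fin 2) (Fin 2) ℂ)
    (hXh : X.IsHermitian) (hXproj : X * X = X) (hXrank : X.rank = 1) :
    shadowNormSq pauli6 (fun k => (9 : ℂ) • pauli6 k - 1) X = 3/2 := by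
  have hdet : X.det = 0 := det_eq_zero_of_rank_lt (by simp [hXrank])
  have hne : X ≠ 0 := by
    rintro rfl
    simp at hXrank
  have htr : X.trace = 1 := trace_eq_one_of_mul_self_eq_self hXproj hne hdet
  rw [shadowNormSq, sum_pauli6_shadow_sq_smul hXh htr hdet]
  refine lambdaMax_fin_two_eq (b := 1 / 2) ?_ (by norm_num) ?_ ?_
  · refine Matrix.IsHermitian.add ?_ hXh
    simp [Matrix.IsHermitian, Matrix.conjTranspose_smul]
  · rw [Matrix.trace_add, htr]
    simp [Matrix.trace_smul]
    norm_num
  · rw [Matrix.det_fin_two] at hdet ⊢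
    rw [Matrix.trace_fin_two] at htr
    simp
    linear_combination hdet + (1 / 2) * htr
end
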